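/- The set S = {(r,s) ∈ 𝔽_q × 𝔽_q : r ≠ s, s² − s + (d + e − 4de) ≠ 0, and H(r,s) = 0} has exactly 3q − 7 elements, and the subset of S consisting of pairs with additionally r² − r + (d + e − 4de) ≠ 0 has exactly 3q − 9 elements, where H(r,s) = [(2s−1)·r + (−s² − 4de + d + e)] · [(1−4d)(1−4e)·r² + (−32de + 8d + 8e − 2)s·r + (−s⁴ + 2s³ + (24de − 6d − 6e)s² + (−8de + 2d + 2e)s + (−16d²e² + 8d²e − d² + 8de² − 2de − e²))]. -/

import Mathlib

open Polynomial

/-- An irreducible `T² + T + d` has non-square discriminant. -/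
lemma not_isSquare_of_irreducible {F : Type*} [Field F] (h2 : (2 : F) ≠ 0) {d : F}
    (hd : Irreducible (X ^ 2 + X + C d : F[X])) : ¬ IsSquare (1 - 4 * d) := by
  rintro ⟨a, ha⟩
  have hdeg : (X ^ 2 + X + C d : F[X]).natDegree = 2 := by compute_degree!
  have hroot : (X ^ 2 + X + C d : F[X]).IsRoot ((a - 1) / 2) := by
    simp only [IsRoot.def, eval_add, eval_pow, eval_X, eval_C]
    field_simp
    linear_combination -ha
  have h1 := degree_eq_one_of_irreducible_of_root hd hroot
  rw [degree_eq_natDegree hd.ne_zero, hdeg] at h1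
  norm_num at h1

/-- In a finite field a product of two non-squares is a square. -/
lemma isSquare_mul_of_not_isSquare {F : Type*} [Field F] [Fintype F] {a b : F}
    (ha : ¬ IsSquare a) (hb : ¬ IsSquare b) : IsSquare (a * b) := by
  classical
  have ha0 : a ≠ 0 := by rintro rfl; exact ha IsSquare.zero
  have hb0 : b ≠ 0 := by rintro rfl; exact hb IsSquare.zero
  rw [← quadraticChar_neg_one_iff_not_isSquare] at ha hb
  rw [← quadraticChar_one_iff_isSquare (mul_ne_zero ha0 hb0), map_mul, ha, hb]
  norm_num

/-- The pairs of the pencil, in coordinates normalised so that its singular members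
are at `±1`. -/
def normalizedPairs (F : Type*) [Field F] : Set (F × F) :=
  {p | p.1 ≠ p.2 ∧ p.2 ^ 2 - 1 ≠ 0 ∧
    (2 * p.1 * p.2 - p.2 ^ 2 - 1) * (4 * (p.1 - p.2) ^ 2 - (p.2 ^ 2 - 1) ^ 2) = 0}

lemma ncard_image_graph {F : Type*} (g : F → F) (T : Set F) :
    ((fun y => (g y, y)) '' T).ncard = T.ncard :=
  Set.ncard_image_of_injective _ fun _ _ h => (Prod.ext_iff.1 h).2

lemma normalizedPairs_eq {F : Type*} [Field F] (h2 : (2 : F) ≠ 0) :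
    normalizedPairs F =
      ((fun y => (y + (y ^ 2 - 1) / 2, y)) '' ({1, -1}ᶜ : Set F) ∪
        (fun y => (y - (y ^ 2 - 1) / 2, y)) '' ({1, -1}ᶜ : Set F)) ∪
      (fun y => ((y ^ 2 + 1) / (2 * y), y)) '' ({0, 1, -1}ᶜ : Set F) := by
  have hsq (y : F) : y ^ 2 - 1 ≠ 0 ↔ ¬ (y = 1 ∨ y = -1) := by
    rw [sub_ne_zero, Ne, sq_eq_one_iff]
  ext ⟨x, y⟩
  simp only [normalizedPairs, Set.mem_ofPred_eq, Set.mem_union, Set.mem_image, Set.mem_compl_iff,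
    Set.mem_insert_iff, Set.mem_singleton_iff, Prod.mk.injEq, exists_eq_right_right]
  constructor
  · rintro ⟨hxy, hy, h⟩
    have hy' := (hsq y).1 hy
    rcases mul_eq_zero.1 h with h | h
    · right
      have hy0 : y ≠ 0 := by
        rintro rfl
        simp at h
      refine ⟨by tauto, ?_⟩
      field_simp
      linear_combination -h
    · left
      have h' : (2 * (x - y) - (y ^ 2 - 1)) * (2 * (x - y) + (y ^ 2 - 1)) = 0 := by
        linear_combination h
      rcases mul_eq_zero.1 h' with h' | h'
      · refine .inl ⟨hy', ?_⟩
        field_simp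
        linear_combination -h'
      · refine .inr ⟨hy', ?_⟩
        field_simp
        linear_combination -h'
  · rintro ((⟨hy, rfl⟩ | ⟨hy, rfl⟩) | ⟨hy, rfl⟩)
    · have hy' := (hsq y).2 hy
      refine ⟨fun h => hy' ?_, hy', ?_⟩
      · field_simp at h
        linear_combination h
      · field_simp
        ring
    · have hy' := (hsq y).2 hy
      refine ⟨fun h => hy' ?_, hy', ?_⟩
      · field_simp at h
        linear_combination -h
      · field_simp
        ring
    · have hy0 : y ≠ 0 := by tauto
      have hy' := (hsq y).2 (by tauto)
      refine ⟨fun h => hy' ?_, hy', ?_⟩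
      · field_simp at h
        linear_combination -h
      · field_simp
        ring

lemma ncard_normalizedPairs {F : Type*} [Field F] [Fintype F] (h2 : (2 : F) ≠ 0) :
    (normalizedPairs F).ncard + 7 = 3 * Fintype.card F := by
  have h11 : (1 : F) ≠ -1 := fun h => h2 (by linear_combination h)
  have hsq (y : F) (hy : ¬ (y = 1 ∨ y = -1)) : y ^ 2 - 1 ≠ 0 := by
    rwa [sub_ne_zero, Ne, sq_eq_one_iff]
  have hT := Set.ncard_add_ncard_compl ({1, -1} : Set F)
  have hT' := Set.ncard_add_ncard_compl ({0, 1, -1} : Set F)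
  rw [Set.ncard_pair h11, Nat.card_eq_fintype_card] at hT
  rw [Set.ncard_insert_of_notMem (by simp), Set.ncard_pair h11,
    Nat.card_eq_fintype_card] at hT'
  rw [normalizedPairs_eq h2, Set.ncard_union_eq _ (Set.toFinite _) (Set.toFinite _),
    Set.ncard_union_eq _ (Set.toFinite _) (Set.toFinite _), ncard_image_graph,
    ncard_image_graph, ncard_image_graph]
  · omega
  · rw [Set.disjoint_left]
    rintro _ ⟨y, hy, rfl⟩ ⟨z, -, hz⟩
    obtain ⟨h, rfl⟩ := Prod.mk.injEq .. ▸ hz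
    refine mul_ne_zero h2 (hsq z hy) ?_
    field_simp at h
    linear_combination -h
  · rw [Set.disjoint_left]
    rintro _ hy ⟨z, hz, rfl⟩
    have hz0 : z ≠ 0 := fun h => hz (by simp [h])
    have hz1 := hsq z (fun h => hz (.inr h))
    rcases hy with ⟨y, hy, h⟩ | ⟨y, hy, h⟩
    · obtain ⟨h, rfl⟩ := Prod.mk.injEq .. ▸ h
      field_simp at h
      have : (y ^ 2 - 1) * (y + 1) = 0 := by linear_combination h
      rcases mul_eq_zero.1 this with h | h
      · exact hz1 h
      · exact hz1 (by linear_combination (y - 1) * h)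
    · obtain ⟨h, rfl⟩ := Prod.mk.injEq .. ▸ h
      field_simp at h
      have : (y ^ 2 - 1) * (y - 1) = 0 := by linear_combination -h
      rcases mul_eq_zero.1 this with h | h
      · exact hz1 h
      · exact hz1 (by linear_combination (y + 1) * h)

/-- Only two normalised pairs have a singular first member. -/
lemma normalizedPairs_inter_singular {F : Type*} [Field F] (h2 : (2 : F) ≠ 0) :
    normalizedPairs F ∩ {p | p.1 ^ 2 - 1 = 0} = {(1, -3), (-1, 3)} := by
  have h8 : (8 : F) ≠ 0 := by
    have := pow_ne_zero 3 h2
    norm_num at this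
    exact this
  have h4 : (4 : F) ≠ 0 := by
    have := pow_ne_zero 2 h2
    norm_num at this
    exact this
  ext ⟨x, y⟩
  simp only [normalizedPairs, Set.mem_inter_iff, Set.mem_ofPred_eq, Set.mem_insert_iff,
    Set.mem_singleton_iff, Prod.mk.injEq]
  constructor
  · rintro ⟨⟨hxy, hy, h⟩, hx⟩
    have hy1 : y - 1 ≠ 0 := fun h => hy (by linear_combination (y + 1) * h)
    have hy2 : y + 1 ≠ 0 := fun h => hy (by linear_combination (y - 1) * h)
    rcases sq_eq_one_iff.1 (sub_eq_zero.1 hx) with rfl | rfl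
    · have h' : (y - 1) ^ 5 * (y + 3) = 0 := by linear_combination h
      exact .inl ⟨rfl, by
        linear_combination (mul_eq_zero.1 h').resolve_left (pow_ne_zero 5 hy1)⟩
    · have h' : (y + 1) ^ 5 * (y - 3) = 0 := by linear_combination h
      exact .inr ⟨rfl, by
        linear_combination (mul_eq_zero.1 h').resolve_left (pow_ne_zero 5 hy2)⟩
  · rintro (⟨rfl, rfl⟩ | ⟨rfl, rfl⟩)
    · refine ⟨⟨fun h => h4 (by linear_combination h), fun h => h8 (by linear_combination h), ?_⟩,
        ?_⟩ <;> ring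
    · refine ⟨⟨fun h => h4 (by linear_combination -h), fun h => h8 (by linear_combination h), ?_⟩,
        ?_⟩ <;> ring

lemma ncard_normalizedPairs_smooth {F : Type*} [Field F] [Fintype F] (h2 : (2 : F) ≠ 0) :
    (normalizedPairs F ∩ {p | p.1 ^ 2 - 1 ≠ 0}).ncard + 9 = 3 * Fintype.card F := by
  have h := Set.ncard_inter_add_ncard_sdiff_eq_ncard (normalizedPairs F)
    {p | p.1 ^ 2 - 1 = 0} (Set.toFinite _)
  rw [normalizedPairs_inter_singular h2, Set.ncard_pair
    fun h => h2 (by linear_combination (Prod.ext_iff.1 h).1)] at h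
  have h' := ncard_normalizedPairs h2
  have : normalizedPairs F ∩ {p | p.1 ^ 2 - 1 ≠ 0} =
      normalizedPairs F \ {p | p.1 ^ 2 - 1 = 0} := rfl
  rw [this]
  omega

/-- The affine change of coordinates sending `±1` to the roots `(1 ± m) / 2`. -/
noncomputable def affineEquiv {F : Type*} [Field F] (h2 : (2 : F) ≠ 0) {m : F} (hm : m ≠ 0) :
    F ≃ F where
  toFun x := (1 + m * x) / 2
  invFun r := (2 * r - 1) / m
  left_inv x := by field_simp; ring
  right_inv r := by field_simp; ring

/-- `T² + T + d` and `T² + T + e` irreducible. For the Cayley coefficient `H₃`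
of the pencil `𝒫₁₆`, the set `S` of pairs `(r,s)` with `r ≠ s`, `s² − s + (d + e − 4de) ≠ 0`
and `H(r,s) = 0` has exactly `3q − 7` elements, and the subset of `S` with additionally
`r² − r + (d + e − 4de) ≠ 0` has exactly `3q − 9` elements. -/
theorem stmt12 {F : Type*} [Field F] [Fintype F]
    (h2 : ringChar F ≠ 2) (d e : F)
    (hd : Irreducible (X ^ 2 + X + C d : F[X]))
    (he : Irreducible (X ^ 2 + X + C e : F[X])) :
    {p : F × F | p.1 ≠ p.2 ∧ p.2 ^ 2 - p.2 + (d + e - 4 * d * e) ≠ 0 ∧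
        ((2 * p.2 - 1) * p.1 + (-p.2 ^ 2 - 4 * d * e + d + e)) *
          ((1 - 4 * d) * (1 - 4 * e) * p.1 ^ 2 +
            (-32 * d * e + 8 * d + 8 * e - 2) * p.2 * p.1 +
            (-p.2 ^ 4 + 2 * p.2 ^ 3 + (24 * d * e - 6 * d - 6 * e) * p.2 ^ 2 +
              (-8 * d * e + 2 * d + 2 * e) * p.2 +
              (-16 * d ^ 2 * e ^ 2 + 8 * d ^ 2 * e - d ^ 2 + 8 * d * e ^ 2 -
                2 * d * e - e ^ 2))) = 0}.ncard = 3 * Fintype.card F - 7 ∧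
    {p : F × F | p.1 ≠ p.2 ∧ p.2 ^ 2 - p.2 + (d + e - 4 * d * e) ≠ 0 ∧
        ((2 * p.2 - 1) * p.1 + (-p.2 ^ 2 - 4 * d * e + d + e)) *
          ((1 - 4 * d) * (1 - 4 * e) * p.1 ^ 2 +
            (-32 * d * e + 8 * d + 8 * e - 2) * p.2 * p.1 +
            (-p.2 ^ 4 + 2 * p.2 ^ 3 + (24 * d * e - 6 * d - 6 * e) * p.2 ^ 2 +
              (-8 * d * e + 2 * d + 2 * e) * p.2 +
              (-16 * d ^ 2 * e ^ 2 + 8 * d ^ 2 * e - d ^ 2 + 8 * d * e ^ 2 -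
                2 * d * e - e ^ 2))) = 0 ∧
        p.1 ^ 2 - p.1 + (d + e - 4 * d * e) ≠ 0}.ncard = 3 * Fintype.card F - 9 := by
  have h2' : (2 : F) ≠ 0 := Ring.two_ne_zero h2
  have hD := not_isSquare_of_irreducible h2' hd
  have hE := not_isSquare_of_irreducible h2' he
  obtain ⟨m, hm⟩ := isSquare_mul_of_not_isSquare hD hE
  have hm0 : m ≠ 0 := by
    rintro rfl
    rcases mul_eq_zero.1 (hm.trans (mul_zero 0)) with h | h
    · exact hD (h ▸ IsSquare.zero)
    · exact hE (h ▸ IsSquare.zero)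
  have h4 : (4 : F) ≠ 0 := by
    have := pow_ne_zero 2 h2'
    norm_num at this
    exact this
  let φ := (affineEquiv h2' hm0).prodCongr (affineEquiv h2' hm0)
  have hw (x : F) : affineEquiv h2' hm0 x ^ 2 - affineEquiv h2' hm0 x +
      (d + e - 4 * d * e) = m ^ 2 / 4 * (x ^ 2 - 1) := by
    simp only [affineEquiv, Equiv.coe_fn_mk]
    field_simp
    linear_combination -4 * hm
  have hsub (x y : F) : affineEquiv h2' hm0 x - affineEquiv h2' hm0 y = m / 2 * (x - y) := by
    simp only [affineEquiv, Equiv.coe_fn_mk]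
    ring
  have hc : m ^ 2 / 4 ≠ 0 := div_ne_zero (pow_ne_zero 2 hm0) h4
  have hH (r s : F) :
      ((2 * s - 1) * r + (-s ^ 2 - 4 * d * e + d + e)) *
          ((1 - 4 * d) * (1 - 4 * e) * r ^ 2 +
            (-32 * d * e + 8 * d + 8 * e - 2) * s * r +
            (-s ^ 4 + 2 * s ^ 3 + (24 * d * e - 6 * d - 6 * e) * s ^ 2 +
              (-8 * d * e + 2 * d + 2 * e) * s +
              (-16 * d ^ 2 * e ^ 2 + 8 * d ^ 2 * e - d ^ 2 + 8 * d * e ^ 2 -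
                2 * d * e - e ^ 2))) =
        (2 * (r - s) * s - (r - s) + (s ^ 2 - s + (d + e - 4 * d * e))) *
          (m ^ 2 * (r - s) ^ 2 - (s ^ 2 - s + (d + e - 4 * d * e)) ^ 2) := by
    rw [pow_two m, ← hm]
    ring
  have hφ (x y : F) : 2 * (m / 2 * (x - y)) * affineEquiv h2' hm0 y - m / 2 * (x - y) +
      m ^ 2 / 4 * (y ^ 2 - 1) = m ^ 2 / 4 * (2 * x * y - y ^ 2 - 1) := by
    simp only [affineEquiv, Equiv.coe_fn_mk]
    field_simp
    ring
  have hQ (x y : F) : m ^ 2 * (m / 2 * (x - y)) ^ 2 - (m ^ 2 / 4 * (y ^ 2 - 1)) ^ 2 =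
      (m ^ 2 / 4) ^ 2 * (4 * (x - y) ^ 2 - (y ^ 2 - 1) ^ 2) := by
    field_simp
    ring
  have key (A : Set (F × F)) (B : Set (F × F)) (hAB : φ ⁻¹' A = B) : A.ncard = B.ncard := by
    rw [← hAB, Set.ncard_preimage_of_injective_subset_range φ.injective (by simp)]
  constructor
  · rw [key _ (normalizedPairs F), ← ncard_normalizedPairs h2', Nat.add_sub_cancel]
    ext ⟨x, y⟩
    simp only [normalizedPairs, φ, Set.mem_preimage, Equiv.prodCongr_apply, Prod.map_apply,
      Set.mem_ofPred_eq, hH, hw, hsub, hφ, hQ, ne_eq, mul_eq_zero, hc, false_or,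
      pow_eq_zero_iff two_ne_zero, EmbeddingLike.apply_eq_iff_eq]
  · rw [key _ (normalizedPairs F ∩ {p | p.1 ^ 2 - 1 ≠ 0}), ← ncard_normalizedPairs_smooth h2',
      Nat.add_sub_cancel]
    ext ⟨x, y⟩
    simp only [normalizedPairs, φ, Set.mem_preimage, Equiv.prodCongr_apply, Prod.map_apply,
      Set.mem_inter_iff, Set.mem_ofPred_eq, hH, hw, hsub, hφ, hQ, ne_eq, mul_eq_zero, hc, false_or,
      pow_eq_zero_iff two_ne_zero, EmbeddingLike.apply_eq_iff_eq, and_assoc]
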